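/- arXiv:2410.10990 — 2 statements merged into one kernel-verified Lean document; each statement's English description precedes it below -/
import Mathlib

section
/- Let R be a commutative Noetherian ring, let I, 𝔞 ⊆ R be ideals with I ∩ R° ≠ ∅ and 𝔞 ∩ R° ≠ ∅, and let t > 0 be a real number. Then the Vraciu 𝔞ᵗ-integral closure of I equals the ordinary integral closure of I, and is contained in the Hara–Yoshida 𝔞ᵗ-integral closure: Ī = ^{𝔞ᵗ}Ī ⊆ Ī^{𝔞ᵗ}. -/
open Ideal Filter
open scoped Pointwise

/-- `R°`: the set of elements of `R` not contained in any minimal prime of `R`. -/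
def Rcirc (R : Type*) [CommRing R] : Set R :=
  {c | ∀ P ∈ minimalPrimes R, c ∉ P}

/-- The integral closure of an ideal `I`: elements satisfying an equation
`x^n + r₁ x^{n-1} + ⋯ + rₙ = 0` with `rᵢ ∈ Iⁱ`. -/
def intCl {R : Type*} [CommRing R] (I : Ideal R) : Set R :=
  {x | ∃ n : ℕ, 0 < n ∧ ∃ r : ℕ → R,
    (∀ i, 1 ≤ i → i ≤ n → r i ∈ I ^ i) ∧
    x ^ n + ∑ i ∈ Finset.range n, r (i + 1) * x ^ (n - (i + 1)) = 0}

/-- The Hara–Yoshida `𝔞^t`-integral closure of `I`. -/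
def HYIntCl {R : Type*} [CommRing R] (I a : Ideal R) (t : ℝ) : Set R :=
  {x | ∃ c ∈ Rcirc R, ∃ N : ℕ, ∀ n : ℕ, N ≤ n →
    ∀ y ∈ a ^ ⌈t * (n : ℝ)⌉₊, c * x ^ n * y ∈ I ^ n}

/-- The Vraciu `𝔞^t`-integral closure of `I`. -/
def VIntCl {R : Type*} [CommRing R] (I a : Ideal R) (t : ℝ) : Set R :=
  {x | ∃ c ∈ Rcirc R, ∃ N : ℕ, ∀ n : ℕ, N ≤ n →
    ∀ y ∈ a ^ ⌈t * (n : ℝ)⌉₊, c * x ^ n * y ∈ a ^ ⌈t * (n : ℝ)⌉₊ * I ^ n}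

/-- The `q`-th Frobenius bracket power `I^{[q]}`: the ideal generated by `q`-th powers
of elements of `I`. -/
def fbp {R : Type*} [CommRing R] (I : Ideal R) (q : ℕ) : Ideal R :=
  Ideal.span ((fun x => x ^ q) '' (I : Set R))

/-- The Frobenius closure `I^F` (in characteristic `p`). -/
def frobCl {R : Type*} [CommRing R] (p : ℕ) (I : Ideal R) : Set R :=
  {x | ∃ e : ℕ, x ^ p ^ e ∈ fbp I (p ^ e)}

/-- The tight closure `I^*` (in characteristic `p`). -/
def tightCl {R : Type*} [CommRing R] (p : ℕ) (I : Ideal R) : Set R :=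
  {x | ∃ c ∈ Rcirc R, ∃ E : ℕ, ∀ e : ℕ, E ≤ e → c * x ^ p ^ e ∈ fbp I (p ^ e)}

/-- The Hara–Yoshida `𝔞^t`-Frobenius closure of `I`. -/
def HYFrobCl {R : Type*} [CommRing R] (p : ℕ) (I a : Ideal R) (t : ℝ) : Set R :=
  {x | ∃ E : ℕ, ∀ e : ℕ, E ≤ e →
    ∀ y ∈ a ^ ⌈t * (p : ℝ) ^ e⌉₊, x ^ p ^ e * y ∈ fbp I (p ^ e)}

/-- The Vraciu `𝔞^t`-Frobenius closure of `I`. -/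
def VFrobCl {R : Type*} [CommRing R] (p : ℕ) (I a : Ideal R) (t : ℝ) : Set R :=
  {x | ∃ E : ℕ, ∀ e : ℕ, E ≤ e →
    ∀ y ∈ a ^ ⌈t * (p : ℝ) ^ e⌉₊, x ^ p ^ e * y ∈ a ^ ⌈t * (p : ℝ) ^ e⌉₊ * fbp I (p ^ e)}

/-- The Hara–Yoshida `𝔞^t`-tight closure of `I`. -/
def HYTightCl {R : Type*} [CommRing R] (p : ℕ) (I a : Ideal R) (t : ℝ) : Set R :=
  {x | ∃ c ∈ Rcirc R, ∃ E : ℕ, ∀ e : ℕ, E ≤ e →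
    ∀ y ∈ a ^ ⌈t * (p : ℝ) ^ e⌉₊, c * x ^ p ^ e * y ∈ fbp I (p ^ e)}

/-- The Vraciu `𝔞^t`-tight closure of `I`. -/
def VTightCl {R : Type*} [CommRing R] (p : ℕ) (I a : Ideal R) (t : ℝ) : Set R :=
  {x | ∃ c ∈ Rcirc R, ∃ E : ℕ, ∀ e : ℕ, E ≤ e →
    ∀ y ∈ a ^ ⌈t * (p : ℝ) ^ e⌉₊, c * x ^ p ^ e * y ∈ a ^ ⌈t * (p : ℝ) ^ e⌉₊ * fbp I (p ^ e)}

/-- The `t`-th rational power of an ideal `𝔞`, for `t = num/den ∈ ℚ`. -/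
def ratPow {R : Type*} [CommRing R] (a : Ideal R) (t : ℚ) : Set R :=
  {x | x ^ t.den ∈ intCl (a ^ t.num.toNat)}

/-- `μ(𝔞)`: the minimal number of generators of the ideal `𝔞`. -/
noncomputable def mu {R : Type*} [CommRing R] (a : Ideal R) : ℕ :=
  sInf {m | ∃ s : Finset R, s.card = m ∧ Ideal.span (s : Set R) = a}

section

open Polynomial

variable {R : Type*} [CommRing R]

theorem Rcirc.mul_mem {c d : R} (hc : c ∈ Rcirc R) (hd : d ∈ Rcirc R) : c * d ∈ Rcirc R :=
  fun P hP h => (hP.1.1.mem_or_mem h).elim (hc P hP) (hd P hP)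

theorem Rcirc.pow_mem {c : R} (hc : c ∈ Rcirc R) (n : ℕ) : c ^ n ∈ Rcirc R :=
  fun P hP h => hc P hP (hP.1.1.mem_of_pow_mem n h)

/-- If `K ⊇ J` and `c * Kⁿ ⊆ Jⁿ` for all `n` and a nonzero `c` in a Noetherian domain,
then `J` is a reduction of `K`. -/
theorem Ideal.exists_pow_succ_eq_mul_pow [IsDomain R] [IsNoetherianRing R] {J K : Ideal R}
    (hJK : J ≤ K) {c : R} (hc : c ≠ 0) (h : ∀ n, span {c} * K ^ n ≤ J ^ n) :
    ∃ n, K ^ (n + 1) = J * K ^ n := by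
  let F : J.Filtration R :=
    { N := fun n => span {c} * K ^ n
      mono := fun n => mul_mono_right (pow_le_pow_right n.le_succ)
      smul_le := fun n => by
        rw [smul_eq_mul, mul_left_comm, pow_succ']
        exact mul_mono_right (mul_mono_left hJK) }
  have hF : F ≤ J.stableFiltration ⊤ := fun n => by
    simpa [F] using h n
  obtain ⟨n, hn⟩ := (J.stableFiltration_stable ⊤).of_le hF
  refine ⟨n, ((span_singleton_mul_right_inj hc).mp ?_).symm⟩
  have := hn n le_rfl
  rwa [smul_eq_mul, mul_left_comm] at this

/-- The determinant trick for an element multiplying a finitely generated ideal `N` into `I * N`. -/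
theorem Ideal.exists_monic_eval_mul_eq_zero {I N : Ideal R} (hN : N.FG) {x : R}
    (h : span {x} * N ≤ I * N) :
    ∃ p : R[X], p.Monic ∧ (∀ k, p.coeff k ∈ I ^ (p.natDegree - k)) ∧
      ∀ y ∈ N, p.eval x * y = 0 := by
  have : Module.Finite R N := Module.Finite.iff_fg.mpr hN
  let f : Module.End R N := algebraMap R (Module.End R N) x
  have hf : LinearMap.range f ≤ I • ⊤ := by
    rintro _ ⟨y, rfl⟩
    have hy : x * (y : R) ∈ I * N :=
      h (mul_mem_mul (mem_span_singleton_self x) y.2)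
    rw [Submodule.mem_smul_top_iff]
    simpa [f] using hy
  obtain ⟨p, hp, -, hpc, hp0⟩ :=
    LinearMap.exists_monic_and_natDegree_eq_and_coeff_mem_pow_and_aeval_eq_zero R f I hf
  refine ⟨p, hp, hpc, fun y hy => ?_⟩
  have := LinearMap.congr_fun hp0 ⟨y, hy⟩
  rw [aeval_algebraMap_apply] at this
  simpa using congrArg Subtype.val this

theorem mem_intCl_of_monic {I : Ideal R} {x : R} {p : R[X]} (hp : p.Monic)
    (hc : ∀ k, p.coeff k ∈ I ^ (p.natDegree - k)) {n : ℕ} (h : p.eval x * x ^ n = 0) :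
    x ∈ intCl I := by
  set d := p.natDegree
  refine ⟨d + (n + 1), by omega, fun i => if i ≤ d then p.coeff (d - i) else 0, ?_, ?_⟩
  · intro i _ _
    dsimp only
    split_ifs with hi
    · simpa [Nat.sub_sub_self hi] using hc (d - i)
    · exact zero_mem _
  · have key : ∑ i ∈ Finset.range (d + 1), p.coeff (d - i) * x ^ (d - i) = p.eval x := by
      rw [eval_eq_sum_range, ← Finset.sum_range_reflect]
      refine Finset.sum_congr rfl fun i hi => ?_
      have hi : i ≤ d := Finset.mem_range_succ_iff.mp hi
      rw [Nat.add_sub_cancel, Nat.sub_sub_self hi]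
    rw [Finset.sum_range_succ', Nat.sub_zero, hp.coeff_natDegree, one_mul] at key
    have : ∑ i ∈ Finset.range (d + (n + 1)),
        (if i + 1 ≤ d then p.coeff (d - (i + 1)) else 0) * x ^ (d + (n + 1) - (i + 1)) =
        (∑ i ∈ Finset.range d, p.coeff (d - (i + 1)) * x ^ (d - (i + 1))) * x ^ (n + 1) := by
      rw [Finset.sum_range_add, Finset.sum_mul]
      rw [Finset.sum_eq_zero (s := Finset.range (n + 1)), add_zero]
      · refine Finset.sum_congr rfl fun i hi => ?_
        have hi : i + 1 ≤ d := Finset.mem_range.mp hi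
        rw [if_pos hi, mul_assoc, ← pow_add]
        congr 2
        omega
      · intro i _
        rw [if_neg (by omega), zero_mul]
    rw [this]
    linear_combination x ^ (n + 1) * key + x * h

theorem Ideal.singleton_mul_sup_pow_le {I : Ideal R} {x : R} {n : ℕ}
    (hn : x ^ (n + 1) ∈ I * (I ⊔ span {x}) ^ n) :
    span {x} * (I ⊔ span {x}) ^ n ≤ I * (I ⊔ span {x}) ^ n := by
  have hx : ∀ m ≤ n, span {x} ^ (n - m + 1) * (I ⊔ span {x}) ^ m ≤
      I * (I ⊔ span {x}) ^ n := by
    intro m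
    induction m with
    | zero =>
      intro _
      simpa [span_singleton_pow, span_singleton_le_iff_mem] using hn
    | succ m ih =>
      intro hm
      rw [pow_succ' (I ⊔ span {x}), ← mul_assoc, Ideal.mul_sup, Ideal.sup_mul]
      refine sup_le ?_ ?_
      · rw [mul_comm _ I, mul_assoc]
        refine mul_mono_right ?_
        calc span {x} ^ (n - (m + 1) + 1) * (I ⊔ span {x}) ^ m
            ≤ (I ⊔ span {x}) ^ (n - (m + 1) + 1) * (I ⊔ span {x}) ^ m := by
              gcongr
              exact le_sup_right
          _ = (I ⊔ span {x}) ^ n := by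
              rw [← pow_add]
              congr 1
              omega
      · rw [← pow_succ, show n - (m + 1) + 1 + 1 = n - m + 1 by omega]
        exact ih (by omega)
  simpa using hx n le_rfl

/-- `x` is integral over `I` iff `I` is a reduction of `I + (x)`. -/
theorem mem_intCl_iff [IsNoetherianRing R] {I : Ideal R} {x : R} :
    x ∈ intCl I ↔ ∃ n, x ^ (n + 1) ∈ I * (I ⊔ span {x}) ^ n := by
  constructor
  · rintro ⟨n, hn, r, hr, h⟩
    obtain ⟨n, rfl⟩ := Nat.exists_eq_add_one.mpr hn
    refine ⟨n, ?_⟩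
    rw [eq_neg_of_add_eq_zero_left h]
    refine neg_mem (sum_mem fun i hi => ?_)
    have hi : i < n + 1 := Finset.mem_range.mp hi
    have h1 : r (i + 1) * x ^ (n - i) ∈ I ^ (i + 1) * span {x} ^ (n - i) :=
      mul_mem_mul (hr _ (by omega) (by omega)) (pow_mem_pow (mem_span_singleton_self x) _)
    rw [Nat.add_sub_add_right]
    refine (?_ : I ^ (i + 1) * span {x} ^ (n - i) ≤ _) h1
    calc I ^ (i + 1) * span {x} ^ (n - i)
        ≤ I * (I ⊔ span {x}) ^ i * (I ⊔ span {x}) ^ (n - i) := by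
          rw [pow_succ']
          gcongr
          exacts [le_sup_left, le_sup_right]
      _ = I * (I ⊔ span {x}) ^ n := by
          rw [mul_assoc, ← pow_add, Nat.add_sub_cancel' (by omega)]
  · rintro ⟨n, hn⟩
    obtain ⟨p, hp, hpc, hp0⟩ :=
      exists_monic_eval_mul_eq_zero (IsNoetherian.noetherian _)
        (singleton_mul_sup_pow_le hn)
    exact mem_intCl_of_monic hp hpc
      (hp0 _ (pow_mem_pow (mem_sup_right (mem_span_singleton_self x)) n))

theorem mem_intCl_of_singleton_mul_pow_le [IsDomain R] [IsNoetherianRing R] {I A : Ideal R}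
    (hI : I ≠ ⊥) (hA : A ≠ ⊥) {c x : R} (hc : c ≠ 0)
    (h : ∀ n, span {c} * (A * (I ⊔ span {x})) ^ n ≤ (A * I) ^ n) : x ∈ intCl I := by
  obtain ⟨n, hn⟩ := exists_pow_succ_eq_mul_pow (mul_mono_right le_sup_left) hc h
  have hle : span {x} * (A ^ (n + 1) * (I ⊔ span {x}) ^ n) ≤
      I * (A ^ (n + 1) * (I ⊔ span {x}) ^ n) := by
    calc span {x} * (A ^ (n + 1) * (I ⊔ span {x}) ^ n)
        ≤ (I ⊔ span {x}) * (A ^ (n + 1) * (I ⊔ span {x}) ^ n) := mul_mono_left le_sup_right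
      _ = (A * (I ⊔ span {x})) ^ (n + 1) := by ring
      _ = A * I * (A * (I ⊔ span {x})) ^ n := hn
      _ = I * (A ^ (n + 1) * (I ⊔ span {x}) ^ n) := by ring
  have hne : A ^ (n + 1) * (I ⊔ span {x}) ^ n ≠ ⊥ :=
    mul_ne_zero (pow_ne_zero _ hA)
      (pow_ne_zero _ fun h0 => hI (le_bot_iff.mp (le_sup_left.trans h0.le)))
  obtain ⟨y, hy, hy0⟩ := Submodule.exists_mem_ne_zero_of_ne_bot hne
  obtain ⟨p, hp, hpc, hp0⟩ :=
    exists_monic_eval_mul_eq_zero (IsNoetherian.noetherian _) hle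
  refine mem_intCl_of_monic (n := 0) hp hpc ?_
  simpa [hy0] using hp0 y hy

/-- Integrality over an ideal may be tested modulo the minimal primes. -/
theorem mem_intCl_of_forall_minimalPrimes [IsNoetherianRing R] {I : Ideal R} {x : R}
    (h : ∀ P ∈ minimalPrimes R,
      Ideal.Quotient.mk P x ∈ intCl (I.map (Ideal.Quotient.mk P))) : x ∈ intCl I := by
  have hmul : ∀ {f g : R} {m n : ℕ}, x ^ (m + 1) - f ∈ I * (I ⊔ span {x}) ^ m →
      x ^ (n + 1) - g ∈ I * (I ⊔ span {x}) ^ n →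
      x ^ (m + n + 1 + 1) - f * g ∈ I * (I ⊔ span {x}) ^ (m + n + 1) := by
    intro f g m n hf hg
    have hx : x ∈ I ⊔ span {x} := mem_sup_right (mem_span_singleton_self x)
    have hf' : f ∈ (I ⊔ span {x}) ^ (m + 1) := by
      rw [← sub_sub_cancel (x ^ (m + 1)) f]
      refine sub_mem (pow_mem_pow hx _) ?_
      rw [pow_succ']
      exact mul_mono_left le_sup_left hf
    have e : x ^ (m + n + 1 + 1) - f * g =
        (x ^ (m + 1) - f) * x ^ (n + 1) + f * (x ^ (n + 1) - g) := by ring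
    rw [e]
    refine add_mem ?_ ?_
    · convert mul_mem_mul hf (pow_mem_pow hx (n + 1)) using 1
      ring
    · convert mul_mem_mul hf' hg using 1
      ring
  have hfin : ∀ s : Finset (Ideal R), (s : Set (Ideal R)) ⊆ minimalPrimes R →
      ∃ f, (∀ P ∈ s, f ∈ P) ∧ ∃ n, x ^ (n + 1) - f ∈ I * (I ⊔ span {x}) ^ n := by
    classical
    intro s
    induction s using Finset.induction_on with
    | empty => exact fun _ => ⟨x, by simp, 0, by simp⟩
    | insert P s _ ih =>
      intro hs
      rw [Finset.coe_insert, Set.insert_subset_iff] at hs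
      obtain ⟨f, hfs, m, hf⟩ := ih hs.2
      obtain ⟨n, hn⟩ := mem_intCl_iff.mp (h P hs.1)
      rw [← map_pow, ← Set.image_singleton, ← map_span, ← Ideal.map_sup, ← Ideal.map_pow,
        ← Ideal.map_mul, mem_map_iff_of_surjective _ Ideal.Quotient.mk_surjective] at hn
      obtain ⟨g, hg, hgx⟩ := hn
      refine ⟨f * (x ^ (n + 1) - g), ?_, m + n + 1, hmul hf (by simpa using hg)⟩
      intro Q hQ
      rcases Finset.mem_insert.mp hQ with rfl | hQ
      · exact mul_mem_left _ _ (Ideal.Quotient.eq.mp hgx.symm)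
      · exact mul_mem_right _ _ (hfs Q hQ)
  have hmin := minimalPrimes.finite_of_isNoetherianRing R
  obtain ⟨f, hf, m, hfm⟩ := hfin hmin.toFinset (by simp)
  have hnil : f ∈ (⊥ : Ideal R).radical := by
    rw [← sInf_minimalPrimes, Submodule.mem_sInf]
    exact fun P hP => hf P (hmin.mem_toFinset.mpr hP)
  obtain ⟨q, hq⟩ := hnil
  have hpow : ∀ k, ∃ n, x ^ (n + 1) - f ^ (k + 1) ∈ I * (I ⊔ span {x}) ^ n := by
    intro k
    induction k with
    | zero => exact ⟨m, by simpa using hfm⟩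
    | succ k ih =>
      obtain ⟨n, hn⟩ := ih
      exact ⟨n + m + 1, by rw [pow_succ f]; exact hmul hn hfm⟩
  obtain ⟨n, hn⟩ := hpow q
  refine mem_intCl_iff.mpr ⟨n, ?_⟩
  rwa [pow_succ f, (Submodule.mem_bot R).mp hq, zero_mul, sub_zero] at hn

/-- Given `c * Bⁿ ⊆ Jⁿ` for large `n` and `j ∈ J`, the element `c * j ^ N` multiplies
`(J + B)ⁿ` into `Jⁿ` for every `n`. -/
theorem Ideal.span_mul_sup_pow_le {J B : Ideal R} {c j : R} {N : ℕ} (hj : j ∈ J)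
    (h : ∀ n, N ≤ n → span {c} * B ^ n ≤ J ^ n) (n : ℕ) :
    span {c * j ^ N} * (J ⊔ B) ^ n ≤ J ^ n := by
  rw [← Submodule.add_eq_sup, add_comm, add_pow, Finset.mul_sum]
  refine Finset.sum_induction _ (· ≤ J ^ n) (fun _ _ => sup_le) bot_le fun i hi => ?_
  have hi : i ≤ n := Finset.mem_range_succ_iff.mp hi
  refine (mul_mono_right mul_le_left).trans ?_
  rw [← span_singleton_mul_span_singleton]
  by_cases hN : N ≤ i
  · calc span {c} * span {j ^ N} * (B ^ i * J ^ (n - i))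
        = span {j ^ N} * (span {c} * B ^ i) * J ^ (n - i) := by ring
      _ ≤ J ^ i * J ^ (n - i) := mul_mono_left (mul_le_right.trans (h i hN))
      _ = J ^ n := by rw [← pow_add, Nat.add_sub_cancel' hi]
  · calc span {c} * span {j ^ N} * (B ^ i * J ^ (n - i))
        = (span {c} * B ^ i) * (span {j ^ N} * J ^ (n - i)) := by ring
      _ ≤ span {j ^ N} * J ^ (n - i) := mul_le_right
      _ ≤ J ^ N * J ^ (n - i) :=
          mul_mono_left ((span_singleton_le_iff_mem _).mpr (pow_mem_pow hj N))
      _ ≤ J ^ n := by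
          rw [← pow_add]
          exact pow_le_pow_right (by omega)

theorem exists_mul_pow_mem_of_mem_intCl [IsNoetherianRing R] {I : Ideal R} {x : R}
    (hx : x ∈ intCl I) {c : R} (hc : c ∈ I) : ∃ k, ∀ n, k ≤ n → c ^ k * x ^ n ∈ I ^ n := by
  obtain ⟨k, hk⟩ := mem_intCl_iff.mp hx
  have hle : ∀ n, span {x} ^ n * (I ⊔ span {x}) ^ k ≤ I ^ n * (I ⊔ span {x}) ^ k := by
    intro n
    induction n with
    | zero => simp
    | succ n ih =>
      calc span {x} ^ (n + 1) * (I ⊔ span {x}) ^ k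
          = span {x} * (span {x} ^ n * (I ⊔ span {x}) ^ k) := by ring
        _ ≤ span {x} * (I ^ n * (I ⊔ span {x}) ^ k) := mul_mono_right ih
        _ = I ^ n * (span {x} * (I ⊔ span {x}) ^ k) := by ring
        _ ≤ I ^ n * (I * (I ⊔ span {x}) ^ k) := mul_mono_right (singleton_mul_sup_pow_le hk)
        _ = I ^ (n + 1) * (I ⊔ span {x}) ^ k := by ring
  have hxn : ∀ n, x ^ (k + n) ∈ I ^ n := by
    intro n
    have hx := mem_span_singleton_self x
    rw [add_comm, pow_add]
    exact mul_le_left (hle n (mul_mem_mul (pow_mem_pow hx n)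
      (pow_mem_pow (mem_sup_right hx) k)))
  refine ⟨k, fun n hn => ?_⟩
  obtain ⟨n, rfl⟩ := Nat.exists_eq_add_of_le hn
  rw [pow_add I]
  exact mul_mem_mul (pow_mem_pow hc k) (hxn n)

theorem intCl_subset_VIntCl [IsNoetherianRing R] {I : Ideal R} (a : Ideal R)
    (hI : ∃ c ∈ Rcirc R, c ∈ I) (t : ℝ) : intCl I ⊆ VIntCl I a t := by
  intro x hx
  obtain ⟨c, hc, hcI⟩ := hI
  obtain ⟨k, hk⟩ := exists_mul_pow_mem_of_mem_intCl hx hcI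
  exact ⟨c ^ k, Rcirc.pow_mem hc k, k, fun n hn y hy => by
    rw [mul_comm _ y]
    exact mul_mem_mul hy (hk n hn)⟩

theorem VIntCl_subset_intCl [IsNoetherianRing R] {I a : Ideal R}
    (hI : ∃ c ∈ Rcirc R, c ∈ I) (ha : ∃ c ∈ Rcirc R, c ∈ a) (t : ℝ) :
    VIntCl I a t ⊆ intCl I := by
  rintro x ⟨c, hc, N, h⟩
  obtain ⟨i, hi, hiI⟩ := hI
  obtain ⟨α, hα, hαa⟩ := ha
  set k := ⌈t⌉₊
  have hkn : ∀ n : ℕ, ⌈t * n⌉₊ ≤ k * n := fun n =>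
    Nat.ceil_le.mpr (by push_cast; gcongr; exact Nat.le_ceil t)
  have hB : ∀ n, N ≤ n → span {c} * (a ^ k * span {x}) ^ n ≤ (a ^ k * I) ^ n := by
    intro n hn
    have h1 : span {c * x ^ n} * a ^ ⌈t * (n : ℝ)⌉₊ ≤ a ^ ⌈t * (n : ℝ)⌉₊ * I ^ n :=
      span_singleton_mul_le_iff.mpr (h n hn)
    have h2 : (a ^ k) ^ n = a ^ (k * n - ⌈t * (n : ℝ)⌉₊) * a ^ ⌈t * (n : ℝ)⌉₊ := by
      rw [← pow_mul, ← pow_add, Nat.sub_add_cancel (hkn n)]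
    calc span {c} * (a ^ k * span {x}) ^ n
        = a ^ (k * n - ⌈t * (n : ℝ)⌉₊) * (span {c * x ^ n} * a ^ ⌈t * (n : ℝ)⌉₊) := by
          rw [mul_pow, h2, ← span_singleton_mul_span_singleton, ← span_singleton_pow]
          ring
      _ ≤ a ^ (k * n - ⌈t * (n : ℝ)⌉₊) * (a ^ ⌈t * (n : ℝ)⌉₊ * I ^ n) := mul_mono_right h1
      _ = (a ^ k * I) ^ n := by rw [mul_pow, h2, mul_assoc]
  have hj : α ^ k * i ∈ a ^ k * I := mul_mem_mul (pow_mem_pow hαa k) hiI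
  have hle := span_mul_sup_pow_le hj hB
  have hc' : c * (α ^ k * i) ^ N ∈ Rcirc R :=
    Rcirc.mul_mem hc (Rcirc.pow_mem (Rcirc.mul_mem (Rcirc.pow_mem hα k) hi) N)
  refine mem_intCl_of_forall_minimalPrimes fun P hP => ?_
  have : P.IsPrime := hP.1.1
  have hne : ∀ {L : Ideal R} {z : R}, z ∈ Rcirc R → z ∈ L → L.map (Ideal.Quotient.mk P) ≠ ⊥ :=
    fun hz hzL h0 => hz P hP (Ideal.Quotient.eq_zero_iff_mem.mp
      ((Submodule.mem_bot _).mp (h0 ▸ mem_map_of_mem _ hzL)))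
  refine mem_intCl_of_singleton_mul_pow_le (hne hi hiI)
    (hne (Rcirc.pow_mem hα k) (pow_mem_pow hαa k))
    (fun h0 => hc' P hP (Ideal.Quotient.eq_zero_iff_mem.mp h0)) fun n => ?_
  have := map_mono (f := Ideal.Quotient.mk P) (hle n)
  rwa [← Ideal.mul_sup, Ideal.map_mul, Ideal.map_pow, Ideal.map_mul, Ideal.map_sup,
    Ideal.map_pow (I := a ^ k * I), Ideal.map_mul, map_span, map_span, Set.image_singleton,
    Set.image_singleton] at this

theorem VIntCl_subset_HYIntCl (I a : Ideal R) (t : ℝ) : VIntCl I a t ⊆ HYIntCl I a t :=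
  fun _ ⟨c, hc, N, h⟩ => ⟨c, hc, N, fun n hn y hy => mul_le_right (h n hn y hy)⟩

end

theorem vraciu_integral_closure_eq_integral_closure {R : Type*} [CommRing R]
    [IsNoetherianRing R] (I a : Ideal R)
    (hI : ∃ c ∈ Rcirc R, c ∈ I) (ha : ∃ c ∈ Rcirc R, c ∈ a) (t : ℝ) (ht : 0 < t) :
    intCl I = VIntCl I a t ∧ VIntCl I a t ⊆ HYIntCl I a t := by
  exact ⟨(intCl_subset_VIntCl a hI t).antisymm (VIntCl_subset_intCl hI ha t),
    VIntCl_subset_HYIntCl I a t⟩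
end

section
/- Let R be a commutative Noetherian ring, let I, 𝔞 ⊆ R be ideals with I ∩ R° ≠ ∅ and 𝔞 ∩ R° ≠ ∅, and let t ≥ 1 be a real number. Then Ī^{𝔞ᵗ} ⊆ (Ī^{𝔞^{t-1}} : 𝔞). Moreover, if 𝔞 is a principal ideal or if t is an integer, then Ī^{𝔞ᵗ} = (Ī^{𝔞^{t-1}} : 𝔞). -/
open Ideal Filter
open scoped Pointwise

lemma one_mem_Rcirc {R : Type*} [CommRing R] : (1 : R) ∈ Rcirc R :=
  fun P hP h => hP.1.1.ne_top ((Ideal.eq_top_iff_one P).2 h)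

lemma mul_mem_Rcirc {R : Type*} [CommRing R] {c d : R} (hc : c ∈ Rcirc R) (hd : d ∈ Rcirc R) :
    c * d ∈ Rcirc R :=
  fun P hP h => (hP.1.1.mem_or_mem h).elim (hc P hP) (hd P hP)

lemma pow_mem_Rcirc {R : Type*} [CommRing R] {c : R} (hc : c ∈ Rcirc R) (n : ℕ) :
    c ^ n ∈ Rcirc R :=
  fun P hP h => hc P hP (hP.1.1.mem_of_pow_mem n h)

/-- An asymptotic containment `c * x ^ n ∈ I ^ n` can be made to hold for every `n`. -/
lemma exists_mul_pow_mem_of_eventually {R : Type*} [CommRing R] {I : Ideal R}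
    (hI : ∃ c ∈ Rcirc R, c ∈ I) {x : R}
    (hx : ∃ c ∈ Rcirc R, ∃ N : ℕ, ∀ n, N ≤ n → c * x ^ n ∈ I ^ n) :
    ∃ c ∈ Rcirc R, ∀ n, c * x ^ n ∈ I ^ n := by
  obtain ⟨d, hd, hdI⟩ := hI
  obtain ⟨c, hc, N, h⟩ := hx
  refine ⟨c * d ^ N, mul_mem_Rcirc hc (pow_mem_Rcirc hd N), fun n => ?_⟩
  rcases le_total N n with hn | hn
  · rw [mul_right_comm]
    exact Ideal.mul_mem_right _ _ (h n hn)
  · rw [mul_right_comm]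
    exact Ideal.mul_mem_left _ _ (Ideal.pow_le_pow_right hn (Ideal.pow_mem_pow hdI N))

lemma exists_mul_sup_pow_le {R : Type*} [CommRing R] {I J K : Ideal R}
    (hJ : ∃ c ∈ Rcirc R, ∀ n, Ideal.span {c} * J ^ n ≤ I ^ n)
    (hK : ∃ c ∈ Rcirc R, ∀ n, Ideal.span {c} * K ^ n ≤ I ^ n) :
    ∃ c ∈ Rcirc R, ∀ n, Ideal.span {c} * (J ⊔ K) ^ n ≤ I ^ n := by
  obtain ⟨c, hc, h⟩ := hJ
  obtain ⟨d, hd, h'⟩ := hK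
  refine ⟨c * d, mul_mem_Rcirc hc hd, fun n => ?_⟩
  rw [← Submodule.add_eq_sup, add_pow, Finset.mul_sum, Ideal.sum_eq_sup, Finset.sup_le_iff]
  intro i hi
  have hin : i + (n - i) = n := by
    have := Finset.mem_range.1 hi
    omega
  calc Ideal.span {c * d} * (J ^ i * K ^ (n - i) * (n.choose i : Ideal R))
      ≤ Ideal.span {c * d} * (J ^ i * K ^ (n - i)) := Ideal.mul_mono_right Ideal.mul_le_left
    _ = (Ideal.span {c} * J ^ i) * (Ideal.span {d} * K ^ (n - i)) := by
      rw [← Ideal.span_singleton_mul_span_singleton]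
      ring
    _ ≤ I ^ i * I ^ (n - i) := Ideal.mul_mono (h i) (h' _)
    _ = I ^ n := by rw [← pow_add, hin]

lemma exists_mul_span_pow_le {R : Type*} [CommRing R] {I : Ideal R} {S : Set R} (hS : S.Finite)
    (h : ∀ s ∈ S, ∃ c ∈ Rcirc R, ∀ n, c * s ^ n ∈ I ^ n) :
    ∃ c ∈ Rcirc R, ∀ n, Ideal.span {c} * Ideal.span S ^ n ≤ I ^ n := by
  induction S, hS using Set.Finite.induction_on with
  | empty =>
    refine ⟨1, one_mem_Rcirc, fun n => ?_⟩
    rcases Nat.eq_zero_or_pos n with rfl | hn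
    · simp
    · rw [Ideal.span_empty, ← Ideal.zero_eq_bot, zero_pow hn.ne', mul_zero]
      exact bot_le
  | @insert s S _ _ ih =>
    rw [Ideal.span_insert]
    refine exists_mul_sup_pow_le ?_ (ih fun u hu => h u (Set.mem_insert_of_mem _ hu))
    obtain ⟨c, hc, hcs⟩ := h s (Set.mem_insert _ _)
    refine ⟨c, hc, fun n => ?_⟩
    rw [Ideal.span_singleton_pow, Ideal.span_singleton_mul_span_singleton,
      Ideal.span_singleton_le_iff_mem]
    exact hcs n

lemma ceil_mul_natCast_eq_add {t : ℝ} (ht : 1 ≤ t) (n : ℕ) :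
    ⌈t * (n : ℝ)⌉₊ = n + ⌈(t - 1) * (n : ℝ)⌉₊ := by
  have h : t * (n : ℝ) = (t - 1) * n + n := by ring
  rw [h, Nat.ceil_add_natCast (mul_nonneg (by linarith) n.cast_nonneg), add_comm]

lemma HYIntCl_subset_colon {R : Type*} [CommRing R] (I a : Ideal R) {t : ℝ} (ht : 1 ≤ t) :
    HYIntCl I a t ⊆ {x | ∀ y ∈ a, x * y ∈ HYIntCl I a (t - 1)} := by
  rintro x ⟨c, hc, N, h⟩ y hy
  refine ⟨c, hc, N, fun n hn z hz => ?_⟩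
  have hyz : y ^ n * z ∈ a ^ ⌈t * (n : ℝ)⌉₊ := by
    rw [ceil_mul_natCast_eq_add ht, pow_add]
    exact Ideal.mul_mem_mul (Ideal.pow_mem_pow hy n) hz
  have := h n hn _ hyz
  rwa [← mul_assoc, mul_assoc c, ← mul_pow] at this

lemma colon_span_singleton_subset_HYIntCl {R : Type*} [CommRing R] (I : Ideal R) (f : R) {t : ℝ}
    (ht : 1 ≤ t) :
    {x | ∀ y ∈ Ideal.span {f}, x * y ∈ HYIntCl I (Ideal.span {f}) (t - 1)} ⊆
      HYIntCl I (Ideal.span {f}) t := by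
  intro x hx
  obtain ⟨c, hc, N, h⟩ := hx f (Ideal.mem_span_singleton_self f)
  refine ⟨c, hc, N, fun n hn y hy => ?_⟩
  rw [Ideal.span_singleton_pow, ceil_mul_natCast_eq_add ht, Ideal.mem_span_singleton'] at hy
  obtain ⟨u, rfl⟩ := hy
  have := Ideal.mul_mem_left _ u
    (h n hn _ (Ideal.pow_mem_pow (Ideal.mem_span_singleton_self f) _))
  convert this using 1
  ring

lemma colon_subset_HYIntCl_natCast {R : Type*} [CommRing R] [IsNoetherianRing R] (I a : Ideal R)
    (hI : ∃ c ∈ Rcirc R, c ∈ I) (k : ℕ) :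
    {x | ∀ y ∈ a, x * y ∈ HYIntCl I a k} ⊆ HYIntCl I a ((k + 1 : ℕ) : ℝ) := by
  intro x hx
  obtain ⟨S, hS⟩ := IsNoetherian.noetherian a
  obtain ⟨T, hT⟩ := IsNoetherian.noetherian (a ^ k)
  have hspan : Ideal.span ({x} * ((S : Set R) * (T : Set R))) = Ideal.span {x} * a ^ (k + 1) := by
    rw [← Ideal.span_mul_span', ← Ideal.span_mul_span', pow_succ', ← hT, ← hS]
  obtain ⟨c, hc, h⟩ := exists_mul_span_pow_le (I := I) (S := {x} * ((S : Set R) * (T : Set R)))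
    ((Set.finite_singleton x).mul (S.finite_toSet.mul T.finite_toSet)) (by
      rintro _ ⟨_, rfl, _, ⟨s, hs, u, hu, rfl⟩, rfl⟩
      have hs' : s ∈ a := hS ▸ Submodule.subset_span hs
      have hu' : u ∈ a ^ k := hT ▸ Submodule.subset_span hu
      obtain ⟨c, hc, N, h⟩ := hx s hs'
      refine exists_mul_pow_mem_of_eventually hI ⟨c, hc, N, fun n hn => ?_⟩
      have hun : u ^ n ∈ a ^ ⌈(k : ℝ) * n⌉₊ := by
        rw [← Nat.cast_mul, Nat.ceil_natCast, pow_mul]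
        exact Ideal.pow_mem_pow hu' n
      convert h n hn _ hun using 1
      ring)
  refine ⟨c, hc, 0, fun n _ y hy => ?_⟩
  rw [← Nat.cast_mul, Nat.ceil_natCast, pow_mul] at hy
  apply h n
  rw [hspan, mul_pow, Ideal.span_singleton_pow, mul_assoc]
  exact Ideal.mul_mem_mul (Ideal.mem_span_singleton_self c)
    (Ideal.mul_mem_mul (Ideal.mem_span_singleton_self _) hy)

theorem HY_integral_closure_colon {R : Type*} [CommRing R] [IsNoetherianRing R]
    (I a : Ideal R) (hI : ∃ c ∈ Rcirc R, c ∈ I) (ha : ∃ c ∈ Rcirc R, c ∈ a)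
    (t : ℝ) (ht : 1 ≤ t) :
    HYIntCl I a t ⊆ {x | ∀ y ∈ a, x * y ∈ HYIntCl I a (t - 1)} ∧
    (((∃ f : R, a = Ideal.span {f}) ∨ (∃ m : ℕ, t = (m : ℝ))) →
      HYIntCl I a t = {x | ∀ y ∈ a, x * y ∈ HYIntCl I a (t - 1)}) := by
  refine ⟨HYIntCl_subset_colon I a ht, fun h => (HYIntCl_subset_colon I a ht).antisymm ?_⟩
  rcases h with ⟨f, rfl⟩ | ⟨m, rfl⟩
  · exact colon_span_singleton_subset_HYIntCl I f ht
  · obtain ⟨k, rfl⟩ : ∃ k, m = k + 1 := Nat.exists_eq_add_of_le' (by exact_mod_cast ht)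
    have hk : ((k + 1 : ℕ) : ℝ) - 1 = k := by
      push_cast
      ring
    rw [hk]
    exact colon_subset_HYIntCl_natCast I a hI k
end
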